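/- Let (E,d) be a metric space, X ⊆ E, s > 0 and u, v ∈ ℕ with u < v, and suppose N(X, 4^{−v} s) < ∞. Then for u ≤ j ≤ v there exist integers m(j) ≤ N(X, 4^{−j} s) and non-empty subsets X_{j,l} ⊆ X (u ≤ j ≤ v, 1 ≤ l ≤ m(j)) such that: (1) for each j, (X_{j,l})_{1 ≤ l ≤ m(j)} is a partition of X; (2) Diam X_{j,l} ≤ 4^{−j+1} s; (3) for each j > u and each 1 ≤ l ≤ m(j) there exists 1 ≤ l' ≤ m(j−1) with X_{j,l} ⊆ X_{j−1,l'} (i.e. the partitions are nested, getting coarser as j decreases). -/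

import Mathlib

open MeasureTheory ProbabilityTheory Filter
open scoped ENNReal NNReal

/-- The covering number `N(X, δ)`: minimal number of balls of radius `δ` covering `X`. -/
noncomputable def coveringNumber {E : Type*} [PseudoMetricSpace E] (X : Set E) (δ : ℝ) : ℕ∞ :=
  ⨅ (s : Finset E) (_ : X ⊆ ⋃ x ∈ s, Metric.ball x δ), (s.card : ℕ∞)

section CoveringNumber

variable {E : Type*} [PseudoMetricSpace E] {X : Set E}

lemma coveringNumber_anti {δ ε : ℝ} (h : δ ≤ ε) : coveringNumber X ε ≤ coveringNumber X δ :=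
  le_iInf₂ fun S hS => iInf₂_le S (hS.trans (Set.iUnion₂_mono fun _ _ => Metric.ball_subset_ball h))

lemma exists_cover_card_le_coveringNumber {δ : ℝ} (h : coveringNumber X δ < ⊤) :
    ∃ S : Finset E, X ⊆ ⋃ x ∈ S, Metric.ball x δ ∧ (S.card : ℕ∞) ≤ coveringNumber X δ := by
  have hlt : coveringNumber X δ < coveringNumber X δ + 1 :=
    (ENat.lt_add_one_iff h.ne).2 le_rfl
  conv_lhs at hlt => unfold coveringNumber
  obtain ⟨S, hS⟩ := iInf_lt_iff.1 hlt
  obtain ⟨hcov, hcard⟩ := iInf_lt_iff.1 hS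
  exact ⟨S, hcov, (ENat.lt_add_one_iff h.ne).1 hcard⟩

/-- A map sending each point of `X` to the center of a ball containing it, for an optimal
cover. -/
lemma exists_centerMap {δ : ℝ} (h : coveringNumber X δ < ⊤) :
    ∃ (c : E → E) (S : Finset E), (S.card : ℕ∞) ≤ coveringNumber X δ ∧
      (∀ x ∈ X, c x ∈ S) ∧ ∀ x ∈ X, dist x (c x) ≤ δ := by
  obtain ⟨S, hcov, hcard⟩ := exists_cover_card_le_coveringNumber h
  have hex : ∀ x, ∃ y, x ∈ X → y ∈ S ∧ dist x y ≤ δ := fun x => by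
    by_cases hx : x ∈ X
    · obtain ⟨y, hy, hxy⟩ := Set.mem_iUnion₂.1 (hcov hx)
      exact ⟨y, fun _ => ⟨hy, (Metric.mem_ball.1 hxy).le⟩⟩
    · exact ⟨x, fun hx' => absurd hx' hx⟩
  choose c hc using hex
  exact ⟨c, S, hcard, fun x hx => (hc x hx).1, fun x hx => (hc x hx).2⟩

end CoveringNumber

section NestedLabel

variable {E : Type*} [Nonempty E]

/-- Labels of successively coarser partitions of `X`: every class of the `k`-th labelling gets
as its next label the image under `c (k + 1)` of a representative in `X`. -/
noncomputable def nestedLabel (c : ℕ → E → E) (X : Set E) : ℕ → E → E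
  | 0 => c 0
  | k + 1 => fun x => c (k + 1) (Function.invFunOn (nestedLabel c X k) X (nestedLabel c X k x))

variable {c : ℕ → E → E} {X : Set E}

lemma exists_nestedLabel_eq (k : ℕ) {x : E} (hx : x ∈ X) :
    ∃ y ∈ X, nestedLabel c X k x = c k y := by
  cases k with
  | zero => exact ⟨x, hx, rfl⟩
  | succ k => exact ⟨_, Function.invFunOn_mem ⟨x, hx, rfl⟩, rfl⟩

lemma nestedLabel_succ_eq_of_eq {k : ℕ} {x y : E}
    (h : nestedLabel c X k x = nestedLabel c X k y) :
    nestedLabel c X (k + 1) x = nestedLabel c X (k + 1) y := by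
  simp only [nestedLabel, h]

lemma dist_nestedLabel_le {E : Type*} [PseudoMetricSpace E] [Nonempty E] {c : ℕ → E → E}
    {X : Set E} {r : ℕ → ℝ} {n : ℕ} (hr : ∀ k < n, 4 * r k ≤ r (k + 1))
    (hc : ∀ k ≤ n, ∀ x ∈ X, dist x (c k x) ≤ r k) {k : ℕ} (hk : k ≤ n) {x : E} (hx : x ∈ X) :
    dist x (nestedLabel c X k x) ≤ 2 * r k := by
  induction k generalizing x with
  | zero =>
    have h := hc 0 hk x hx
    have := dist_nonneg.trans h
    simp only [nestedLabel]
    linarith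
  | succ k ih =>
    set y := Function.invFunOn (nestedLabel c X k) X (nestedLabel c X k x) with hy
    have hyX : y ∈ X := Function.invFunOn_mem ⟨x, hx, rfl⟩
    have hyx : nestedLabel c X k y = nestedLabel c X k x :=
      Function.invFunOn_eq (f := nestedLabel c X k) ⟨x, hx, rfl⟩
    have h₁ := ih (by omega) hx
    have h₂ := ih (by omega) hyX
    have h₃ := hc (k + 1) hk y hyX
    have h₄ := hr k (by omega)
    rw [hyx] at h₂
    have h₅ := dist_triangle_right x y (nestedLabel c X k x)
    have h₆ := dist_triangle x y (c (k + 1) y)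
    change dist x (c (k + 1) y) ≤ _
    linarith

end NestedLabel

/-- The fibers over `X` of a map with finite range on `X`, enumerated by `1, …, m`. -/
lemma exists_enum_fibers {E F : Type*} (X : Set E) (f : E → F) (S : Finset F)
    (hf : ∀ x ∈ X, f x ∈ S) :
    ∃ (m : ℕ) (T : ℕ → Set E), m ≤ S.card ∧
      (∀ l, 1 ≤ l → l ≤ m → (T l).Nonempty ∧ T l ⊆ X) ∧
      (⋃ l ∈ Finset.Icc 1 m, T l) = X ∧
      (∀ l l', 1 ≤ l → l ≤ m → 1 ≤ l' → l' ≤ m → l ≠ l' → Disjoint (T l) (T l')) ∧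
      (∀ l, 1 ≤ l → l ≤ m → ∀ x ∈ T l, ∀ y ∈ T l, f x = f y) ∧
      (∀ l, 1 ≤ l → l ≤ m → ∀ x ∈ T l, ∀ y ∈ X, f y = f x → y ∈ T l) := by
  classical
  have hsub : f '' X ⊆ S := by rintro _ ⟨x, hx, rfl⟩; exact hf x hx
  have hfin : (f '' X).Finite := S.finite_toSet.subset hsub
  set I := hfin.toFinset with hI
  let e := I.equivFin
  have hmem : ∀ x ∈ X, f x ∈ I := fun x hx => by simpa [hI] using ⟨x, hx, rfl⟩
  refine ⟨I.card, fun l => {x | ∃ hx : x ∈ X, (e ⟨f x, hmem x hx⟩ : ℕ) + 1 = l},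
    Finset.card_le_card fun y hy => hsub (by simpa [hI] using hy), ?_, ?_, ?_, ?_, ?_⟩
  · intro l h1 hl
    refine ⟨?_, fun x hx => hx.1⟩
    obtain ⟨⟨y, hy⟩, hye⟩ := e.surjective ⟨l - 1, by omega⟩
    obtain ⟨x, hx, rfl⟩ : y ∈ f '' X := by simpa [hI] using hy
    refine ⟨x, hx, ?_⟩
    rw [hye]
    simp only
    omega
  · ext x
    simp only [Set.mem_iUnion, Set.mem_ofPred_eq, Finset.mem_Icc]
    constructor
    · rintro ⟨_, _, hx, _⟩
      exact hx
    · intro hx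
      exact ⟨_, ⟨by omega, (e ⟨f x, hmem x hx⟩).isLt⟩, hx, rfl⟩
  · intro l l' _ _ _ _ hne
    rw [Set.disjoint_left]
    rintro x ⟨hx, rfl⟩ ⟨_, h⟩
    exact hne h
  · rintro l _ _ x ⟨hx, h⟩ y ⟨hy, h'⟩
    have : e ⟨f x, hmem x hx⟩ = e ⟨f y, hmem y hy⟩ := Fin.ext (by omega)
    simpa using this
  · rintro l _ _ x ⟨hx, h⟩ y hy hyx
    refine ⟨hy, ?_⟩
    simpa only [hyx] using h

/-- Boissard, Lemma 2.1: existence of a nested sequence of partitions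
adapted to the covering numbers. -/
theorem exists_nested_partitions
    {E : Type*} [MetricSpace E] (X : Set E) (s : ℝ) (hs : 0 < s)
    (u v : ℕ) (huv : u < v)
    (hN : coveringNumber X ((4 : ℝ) ^ (-(v : ℤ)) * s) < ⊤) :
    ∃ (m : ℕ → ℕ) (T : ℕ → ℕ → Set E),
      -- cardinality bound
      (∀ j, u ≤ j → j ≤ v → (m j : ℕ∞) ≤ coveringNumber X ((4 : ℝ) ^ (-(j : ℤ)) * s)) ∧
      -- the tiles are non-empty subsets of X
      (∀ j, u ≤ j → j ≤ v → ∀ l, 1 ≤ l → l ≤ m j → (T j l).Nonempty ∧ T j l ⊆ X) ∧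
      -- (1) for each j, (T j l)_{1 ≤ l ≤ m j} is a partition of X
      (∀ j, u ≤ j → j ≤ v → (⋃ l ∈ Finset.Icc 1 (m j), T j l) = X) ∧
      (∀ j, u ≤ j → j ≤ v → ∀ l l', 1 ≤ l → l ≤ m j → 1 ≤ l' → l' ≤ m j → l ≠ l' →
        Disjoint (T j l) (T j l')) ∧
      -- (2) diameter bound
      (∀ j, u ≤ j → j ≤ v → ∀ l, 1 ≤ l → l ≤ m j →
        Metric.diam (T j l) ≤ (4 : ℝ) ^ (-(j : ℤ) + 1) * s) ∧
      -- (3) nesting: each tile at level j is contained in a tile at level j - 1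
      (∀ j, u < j → j ≤ v → ∀ l, 1 ≤ l → l ≤ m j →
        ∃ l', 1 ≤ l' ∧ l' ≤ m (j - 1) ∧ T j l ⊆ T (j - 1) l') := by
  rcases isEmpty_or_nonempty E with hE | hE
  · exact ⟨fun _ => 0, fun _ _ => ∅, by simp, by intros; simp_all,
      fun _ _ _ => Subsingleton.elim _ _, by simp, by intros; simp_all, by intros; simp_all⟩
  let r : ℕ → ℝ := fun k => (4 : ℝ) ^ (-((v - k : ℕ) : ℤ)) * s
  have hr0 : ∀ k, 0 ≤ r k := fun k => by positivity
  have hr : ∀ k < v, 4 * r k ≤ r (k + 1) := fun k hk => by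
    have : (-((v - (k + 1) : ℕ) : ℤ)) = -((v - k : ℕ) : ℤ) + 1 := by omega
    simp only [r]
    rw [this, zpow_add_one₀ (by norm_num)]
    exact le_of_eq (by ring)
  have hfinite : ∀ k, coveringNumber X (r k) < ⊤ := fun k => by
    refine (coveringNumber_anti ?_).trans_lt hN
    refine mul_le_mul_of_nonneg_right (zpow_le_zpow_right₀ (by norm_num) ?_) hs.le
    omega
  choose c S hcard hcS hdist using fun k => exists_centerMap (hfinite k)
  have hS : ∀ k, ∀ x ∈ X, nestedLabel c X k x ∈ S k := fun k x hx => by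
    obtain ⟨y, hy, h⟩ := exists_nestedLabel_eq (c := c) k hx
    exact h ▸ hcS k y hy
  choose m T hm hT hU hD heq hsat using fun k => exists_enum_fibers X _ (S k) (hS k)
  refine ⟨fun j => m (v - j), fun j => T (v - j), ?_, fun j _ _ => hT _, fun j _ _ => hU _,
    fun j _ _ => hD _, ?_, ?_⟩
  · intro j _ hj
    have h := (Nat.cast_le.2 (hm (v - j))).trans (hcard (v - j))
    simpa only [r, Nat.sub_sub_self hj] using h
  · intro j _ hj l h1 hl
    have hrj : (4 : ℝ) ^ (-(j : ℤ) + 1) * s = 4 * r (v - j) := by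
      simp only [r, Nat.sub_sub_self hj]
      rw [zpow_add_one₀ (by norm_num)]
      ring
    rw [hrj]
    refine Metric.diam_le_of_forall_dist_le (by linarith [hr0 (v - j)]) fun x hx y hy => ?_
    have hle : ∀ z ∈ X, dist z (nestedLabel c X (v - j) z) ≤ 2 * r (v - j) := fun z hz =>
      dist_nestedLabel_le hr (fun k _ => hdist k) (Nat.sub_le v j) hz
    have h₁ := hle x ((hT _ l h1 hl).2 hx)
    have h₂ := hle y ((hT _ l h1 hl).2 hy)
    rw [← heq _ l h1 hl x hx y hy] at h₂
    linarith [dist_triangle_right x y (nestedLabel c X (v - j) x)]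
  · intro j hj hjv l h1 hl
    have hk : v - (j - 1) = v - j + 1 := by omega
    simp only [hk]
    obtain ⟨⟨x, hx⟩, hlX⟩ := hT _ l h1 hl
    have hxU := hlX hx
    rw [← hU (v - j + 1)] at hxU
    obtain ⟨l', hl', hxl'⟩ := Set.mem_iUnion₂.1 hxU
    obtain ⟨h1', hm'⟩ := Finset.mem_Icc.1 hl'
    exact ⟨l', h1', hm', fun y hy => hsat _ l' h1' hm' x hxl' y (hlX hy)
      (nestedLabel_succ_eq_of_eq (heq _ l h1 hl y hy x hx))⟩
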